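/- arXiv:2501.13637 — 2 statements merged into one kernel-verified Lean document; each statement's English description precedes it below -/
import Mathlib

section
/- Let H be a real Hilbert space, F : H ⇉ H a set-valued operator with zer F ≠ ∅, α > 0, L > 0, ℓ ≥ 0, and v : H → H a bijective single-valued L-Lipschitz continuous map whose inverse v⁻¹ is ℓ-Lipschitz continuous, such that the pair (F, v) is α-strongly monotone. Let (γₙ) be a sequence of positive reals with γ := inf γₙ > 0 and ran v ⊆ ran(γₙF + v) for all n. Let x* be the (unique) zero of F, and let (xₙ) be a sequence in H with xₙ₊₁ ∈ J_{γₙF}^v(xₙ) for all n. Then (xₙ) converges to x* with linear rate: for all n, ‖xₙ − x*‖ ≤ ℓL κⁿ ‖x₀ − x*‖, where κ := 1/(1 + αγL⁻²) < 1. -/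
open RealInnerProductSpace Pointwise Filter

/-- The pair `(F, v)` is `α`-strongly monotone. -/
def StronglyMonotonePair {H : Type*} [NormedAddCommGroup H] [InnerProductSpace ℝ H]
    (F : H → Set H) (v : H → H) (α : ℝ) : Prop :=
  ∀ x y : H, ∀ u ∈ F x, ∀ w ∈ F y, α * ‖x - y‖ ^ 2 ≤ ⟪u - w, v x - v y⟫

/-- One step of the warped proximal point iteration contracts the distance of the `v`-images
to the `v`-image of a zero of `F`. -/
theorem StronglyMonotonePair.norm_sub_le_of_mem_smul
    {H : Type*} [NormedAddCommGroup H] [InnerProductSpace ℝ H]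
    {F : H → Set H} {v : H → H} {α L c γ : ℝ} (hmono : StronglyMonotonePair F v α)
    (hα : 0 < α) (hL : 0 < L) (hlip : ∀ x y : H, ‖v x - v y‖ ≤ L * ‖x - y‖)
    (hc : 0 < c) (hcγ : c ≤ γ) {p y z : H} (hz : (0 : H) ∈ F z) (hy : v p - v y ∈ γ • F y) :
    ‖v y - v z‖ ≤ (1 + α * c * (L ^ 2)⁻¹)⁻¹ * ‖v p - v z‖ := by
  obtain ⟨u, hu, huy : γ • u = v p - v y⟩ := hy
  have hinner : α * ‖y - z‖ ^ 2 ≤ ⟪u, v y - v z⟫ := by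
    simpa using hmono y z u hu 0 hz
  have hsq : (L ^ 2)⁻¹ * ‖v y - v z‖ ^ 2 ≤ ‖y - z‖ ^ 2 := by
    rw [inv_mul_le_iff₀ (by positivity), ← mul_pow]
    exact pow_le_pow_left₀ (norm_nonneg _) (hlip y z) 2
  have hsplit : ⟪v p - v z, v y - v z⟫ = γ * ⟪u, v y - v z⟫ + ‖v y - v z‖ ^ 2 := by
    rw [← sub_add_sub_cancel (v p) (v y) (v z), ← huy, inner_add_left, real_inner_smul_left,
      real_inner_self_eq_norm_sq]
  have hlow : α * c * (L ^ 2)⁻¹ * ‖v y - v z‖ ^ 2 ≤ γ * ⟪u, v y - v z⟫ :=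
    calc α * c * (L ^ 2)⁻¹ * ‖v y - v z‖ ^ 2
        = c * (α * ((L ^ 2)⁻¹ * ‖v y - v z‖ ^ 2)) := by ring
      _ ≤ c * (α * ‖y - z‖ ^ 2) := by gcongr
      _ ≤ γ * (α * ‖y - z‖ ^ 2) := by gcongr
      _ ≤ γ * ⟪u, v y - v z⟫ := mul_le_mul_of_nonneg_left hinner (hc.le.trans hcγ)
  have hcs := real_inner_le_norm (v p - v z) (v y - v z)
  rw [le_inv_mul_iff₀ (by positivity)]
  rcases (norm_nonneg (v y - v z)).eq_or_lt with h0 | hpos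
  · simp [← h0]
  · refine le_of_mul_le_mul_right ?_ hpos
    linarith

theorem gppa_linear_convergence_of_x
    {H : Type*} [NormedAddCommGroup H] [InnerProductSpace ℝ H] [CompleteSpace H]
    (F : H → Set H) (v vinv : H → H) (α L ℓ : ℝ)
    (hα : 0 < α) (hL : 0 < L) (hℓ : 0 ≤ ℓ)
    (hzer : ∃ z : H, (0 : H) ∈ F z)
    (hbij : Function.Bijective v)
    (hvinv_left : Function.LeftInverse vinv v)
    (hvinv_right : Function.RightInverse vinv v)
    (hlip : ∀ x y : H, ‖v x - v y‖ ≤ L * ‖x - y‖)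
    (hlipinv : ∀ x y : H, ‖vinv x - vinv y‖ ≤ ℓ * ‖x - y‖)
    (hmono : StronglyMonotonePair F v α)
    (γ : ℕ → ℝ) (hγ : ∀ n, 0 < γ n) (hinf : 0 < ⨅ n, γ n)
    (hran : ∀ n, Set.range v ⊆ {w : H | ∃ z : H, ∃ u ∈ F z, w = γ n • u + v z})
    (xstar : H) (hxstar : (0 : H) ∈ F xstar)
    (x : ℕ → H)
    (hiter : ∀ n, v (x n) - v (x (n + 1)) ∈ γ n • F (x (n + 1))) :
    (1 + α * (⨅ n, γ n) * (L ^ 2)⁻¹)⁻¹ < 1 ∧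
    ∀ n, ‖x n - xstar‖ ≤
      ℓ * L * ((1 + α * (⨅ n, γ n) * (L ^ 2)⁻¹)⁻¹) ^ n * ‖x 0 - xstar‖ := by
  have hstep (n : ℕ) := hmono.norm_sub_le_of_mem_smul hα hL hlip hinf
    (ciInf_le ⟨0, Set.forall_mem_range.2 fun n => (hγ n).le⟩ n) hxstar (hiter n)
  set κ := (1 + α * (⨅ n, γ n) * (L ^ 2)⁻¹)⁻¹
  have hκ0 : 0 ≤ κ := by positivity
  refine ⟨inv_lt_one_of_one_lt₀ (lt_add_of_pos_right 1 (by positivity)), fun n => ?_⟩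
  have hv : ‖v (x n) - v xstar‖ ≤ κ ^ n * ‖v (x 0) - v xstar‖ :=
    le_geom (u := fun n => ‖v (x n) - v xstar‖) hκ0 n fun k _ => hstep k
  calc ‖x n - xstar‖ = ‖vinv (v (x n)) - vinv (v xstar)‖ := by
        rw [hvinv_left, hvinv_left]
    _ ≤ ℓ * ‖v (x n) - v xstar‖ := hlipinv _ _
    _ ≤ ℓ * (κ ^ n * (L * ‖x 0 - xstar‖)) := by
        gcongr
        exact hv.trans (by gcongr; exact hlip _ _)
    _ = ℓ * L * κ ^ n * ‖x 0 - xstar‖ := by ring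
end

section
/- Let H be a real Hilbert space, F : H ⇉ H a set-valued operator with zer F ≠ ∅ and with a strongly-weakly closed graph, and let v : H → H be a bijective single-valued map such that the pair (F, v) is monotone and the inverse map v⁻¹ is weakly continuous. Let (γₙ) be a sequence of positive reals with Σₙ γₙ² = +∞ and ran v ⊆ ran(γₙF + v) for all n. Let (xₙ) be a sequence with x₀ ∈ ran v and xₙ₊₁ ∈ T_{γₙF}^v(xₙ) for all n (i.e. there exists zₙ₊₁ with xₙ − v(zₙ₊₁) ∈ γₙF(zₙ₊₁) and xₙ₊₁ = v(zₙ₊₁)). Then (xₙ) converges weakly to a point x̃ such that v⁻¹(x̃) is a zero of F, i.e. 0 ∈ F(v⁻¹(x̃)). -/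
open RealInnerProductSpace Pointwise Filter

/-- Weak convergence of a sequence in a Hilbert space, expressed via inner products. -/
def WeakConvergesTo {H : Type*} [NormedAddCommGroup H] [InnerProductSpace ℝ H]
    (x : ℕ → H) (p : H) : Prop :=
  ∀ y : H, Tendsto (fun n => ⟪x n, y⟫) atTop (nhds ⟪p, y⟫)

/-- The pair `(F, v)` is monotone. -/
def MonotonePair {H : Type*} [NormedAddCommGroup H] [InnerProductSpace ℝ H]
    (F : H → Set H) (v : H → H) : Prop :=
  ∀ x y : H, ∀ u ∈ F x, ∀ w ∈ F y, 0 ≤ ⟪u - w, v x - v y⟫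

/-- `F` has a strongly-weakly closed graph. -/
def StronglyWeaklyClosedGraph {H : Type*} [NormedAddCommGroup H] [InnerProductSpace ℝ H]
    (F : H → Set H) : Prop :=
  ∀ (xs ys : ℕ → H) (x y : H), WeakConvergesTo xs x → Tendsto ys atTop (nhds y) →
    (∀ n, ys n ∈ F (xs n)) → y ∈ F x

open Topology

/-- Every bounded sequence in a Hilbert space has a weakly convergent subsequence. -/
theorem exists_subseq_weakConvergesTo_of_norm_le
    {H : Type*} [NormedAddCommGroup H] [InnerProductSpace ℝ H] [CompleteSpace H]
    {x : ℕ → H} {C : ℝ} (hC : ∀ n, ‖x n‖ ≤ C) :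
    ∃ (p : H) (φ : ℕ → ℕ), StrictMono φ ∧ WeakConvergesTo (x ∘ φ) p := by
  set K : Submodule ℝ H := (Submodule.span ℝ (Set.range x)).topologicalClosure with hK
  have : CompleteSpace K :=
    (Submodule.isClosed_topologicalClosure _).completeSpace_coe
  have hsep : TopologicalSpace.IsSeparable (K : Set H) := by
    rw [hK, Submodule.topologicalClosure_coe]
    exact (Set.countable_range x).isSeparable.span.closure
  have : TopologicalSpace.SeparableSpace K := hsep.separableSpace
  have hxK (n : ℕ) : x n ∈ K :=
    Submodule.le_topologicalClosure _ (Submodule.subset_span ⟨n, rfl⟩)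
  let f : ℕ → WeakDual ℝ K := fun n =>
    StrongDual.toWeakDual (InnerProductSpace.toDual ℝ K ⟨x n, hxK n⟩)
  obtain ⟨g, -, φ, hφ, hg⟩ := WeakDual.isSeqCompact_closedBall ℝ K 0 C (x := f) fun n => by
    change InnerProductSpace.toDual ℝ K ⟨x n, hxK n⟩ ∈ Metric.closedBall 0 C
    rw [mem_closedBall_zero_iff, LinearIsometryEquiv.norm_map]
    exact hC n
  set p : K := (InnerProductSpace.toDual ℝ K).symm (WeakDual.toStrongDual g) with hp
  refine ⟨p, φ, hφ, fun y => ?_⟩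
  have hy := ((WeakDual.eval_continuous (K.orthogonalProjectionOnto y)).tendsto g).comp hg
  have hgp : g (K.orthogonalProjectionOnto y) = ⟪(p : H), y⟫ := by
    rw [← K.inner_orthogonalProjectionOnto_eq_of_mem_left, hp,
      InnerProductSpace.toDual_symm_apply]
    rfl
  rw [hgp] at hy
  refine hy.congr fun n => ?_
  exact K.inner_orthogonalProjectionOnto_eq_of_mem_left ⟨x (φ n), hxK (φ n)⟩ y

/-- **Opial's lemma**: a bounded sequence whose distance to each of its weak cluster points
converges is weakly convergent, and its limit is one of these cluster points. -/
theorem exists_weakConvergesTo_of_tendsto_norm_sub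
    {H : Type*} [NormedAddCommGroup H] [InnerProductSpace ℝ H] [CompleteSpace H]
    {x : ℕ → H} {C : ℝ} (hC : ∀ n, ‖x n‖ ≤ C) {S : Set H}
    (hS : ∀ (p : H) (φ : ℕ → ℕ), Tendsto φ atTop atTop → WeakConvergesTo (x ∘ φ) p → p ∈ S)
    (hlim : ∀ p ∈ S, ∃ l : ℝ, Tendsto (fun n => ‖x n - p‖ ^ 2) atTop (𝓝 l)) :
    ∃ p ∈ S, WeakConvergesTo x p := by
  obtain ⟨p, φ, hφ, hp⟩ := exists_subseq_weakConvergesTo_of_norm_le hC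
  have hpS := hS p φ hφ.tendsto_atTop hp
  refine ⟨p, hpS, fun y => tendsto_of_subseq_tendsto fun ns hns => ?_⟩
  obtain ⟨q, ψ, hψ, hq⟩ :=
    exists_subseq_weakConvergesTo_of_norm_le (x := x ∘ ns) fun n => hC (ns n)
  have hnsψ : Tendsto (ns ∘ ψ) atTop atTop := hns.comp hψ.tendsto_atTop
  have hqS := hS q (ns ∘ ψ) hnsψ hq
  obtain ⟨lp, hlp⟩ := hlim p hpS
  obtain ⟨lq, hlq⟩ := hlim q hqS
  have hdiff : Tendsto (fun n => ⟪x n, p - q⟫) atTop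
      (𝓝 ((lq - lp + (‖p‖ ^ 2 - ‖q‖ ^ 2)) / 2)) := by
    refine (((hlq.sub hlp).add_const (‖p‖ ^ 2 - ‖q‖ ^ 2)).div_const 2).congr fun n => ?_
    rw [norm_sub_sq_real, norm_sub_sq_real, inner_sub_right]
    ring
  have hpl := tendsto_nhds_unique (hp (p - q)) (hdiff.comp hφ.tendsto_atTop)
  have hql := tendsto_nhds_unique (hq (p - q)) (hdiff.comp hnsψ)
  have hpq : p = q := by
    rw [← sub_eq_zero, ← inner_self_eq_zero (𝕜 := ℝ), inner_sub_left, hpl, hql, sub_self]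
  exact ⟨ψ, hpq ▸ hq y⟩

/-- A nonnegative antitone sequence that is summable against a non-summable nonnegative weight
tends to zero. -/
theorem tendsto_zero_of_antitone_of_summable_mul {a w : ℕ → ℝ} (ha : Antitone a)
    (ha0 : ∀ n, 0 ≤ a n) (hw0 : ∀ n, 0 ≤ w n) (hw : ¬ Summable w)
    (hsum : Summable fun n => w n * a n) : Tendsto a atTop (𝓝 0) := by
  have hbdd : BddBelow (Set.range a) := ⟨0, Set.forall_mem_range.2 ha0⟩
  have hlim := tendsto_atTop_ciInf ha hbdd
  suffices h : ⨅ n, a n = 0 by rwa [h] at hlim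
  by_contra hne
  have hpos : 0 < ⨅ n, a n := lt_of_le_of_ne (le_ciInf ha0) (Ne.symm hne)
  refine hw ((hsum.div_const (⨅ n, a n)).of_nonneg_of_le hw0 fun n => ?_)
  rw [le_div_iff₀ hpos]
  exact mul_le_mul_of_nonneg_left (ciInf_le hbdd n) (hw0 n)

theorem gppa1_weak_convergence
    {H : Type*} [NormedAddCommGroup H] [InnerProductSpace ℝ H] [CompleteSpace H]
    (F : H → Set H) (v vinv : H → H)
    (hzer : ∃ z : H, (0 : H) ∈ F z)
    (hgraph : StronglyWeaklyClosedGraph F)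
    (hbij : Function.Bijective v)
    (hvinv_left : Function.LeftInverse vinv v)
    (hvinv_right : Function.RightInverse vinv v)
    (hmono : MonotonePair F v)
    (hweakcont : ∀ (u : ℕ → H) (p : H), WeakConvergesTo u p →
      WeakConvergesTo (fun n => vinv (u n)) (vinv p))
    (γ : ℕ → ℝ) (hγ : ∀ n, 0 < γ n)
    (hdiv : ¬ Summable (fun n => (γ n) ^ 2))
    (hran : ∀ n, Set.range v ⊆ {w : H | ∃ z : H, ∃ u ∈ F z, w = γ n • u + v z})
    (x : ℕ → H) (hx0 : x 0 ∈ Set.range v)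
    (hiter : ∀ n, ∃ z : H, x n - v z ∈ γ n • F z ∧ x (n + 1) = v z) :
    ∃ xt : H, WeakConvergesTo x xt ∧ (0 : H) ∈ F (vinv xt) := by
  choose z hz hxz using hiter
  choose u hu hxu using fun n => Set.mem_smul_set.1 (hz n)
  have hstep (n : ℕ) : x n = x (n + 1) + γ n • u n := by
    have h : γ n • u n = x n - v (z n) := hxu n
    rw [h, hxz n, add_sub_cancel]
  have hfejer (q : H) (hq : (0 : H) ∈ F (vinv q)) (n : ℕ) :
      ‖x (n + 1) - q‖ ^ 2 + γ n ^ 2 * ‖u n‖ ^ 2 ≤ ‖x n - q‖ ^ 2 := by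
    have h := hmono (z n) (vinv q) (u n) (hu n) 0 hq
    rw [hvinv_right q, ← hxz n, sub_zero, real_inner_comm] at h
    rw [hstep n, add_sub_right_comm, norm_add_sq_real, inner_smul_right, norm_smul, mul_pow,
      Real.norm_eq_abs, sq_abs]
    linarith [mul_nonneg (hγ n).le h]
  have hanti_dist (q : H) (hq : (0 : H) ∈ F (vinv q)) : Antitone fun n => ‖x n - q‖ ^ 2 :=
    antitone_nat_of_succ_le fun n =>
      (le_add_of_nonneg_right (by positivity)).trans (hfejer q hq n)
  have hanti_res : Antitone fun n => ‖u n‖ ^ 2 := by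
    refine antitone_nat_of_succ_le fun n => ?_
    have h := hmono (z n) (z (n + 1)) (u n) (hu n) (u (n + 1)) (hu (n + 1))
    rw [← hxz n, ← hxz (n + 1), hstep (n + 1), add_sub_cancel_left, inner_smul_right] at h
    have h' := nonneg_of_mul_nonneg_right h (hγ (n + 1))
    rw [inner_sub_left, real_inner_self_eq_norm_sq] at h'
    have h2 := norm_sub_sq_real (u n) (u (n + 1))
    nlinarith [sq_nonneg ‖u n - u (n + 1)‖]
  obtain ⟨z₀, hz₀⟩ := hzer
  have hq₀ : (0 : H) ∈ F (vinv (v z₀)) := by rwa [hvinv_left z₀]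
  have hsum : Summable fun n => γ n ^ 2 * ‖u n‖ ^ 2 := by
    refine summable_of_sum_range_le (c := ‖x 0 - v z₀‖ ^ 2) (fun n => by positivity) fun n => ?_
    have h : ∑ i ∈ Finset.range n, γ i ^ 2 * ‖u i‖ ^ 2 ≤
        ∑ i ∈ Finset.range n, (‖x i - v z₀‖ ^ 2 - ‖x (i + 1) - v z₀‖ ^ 2) :=
      Finset.sum_le_sum fun i _ => le_sub_iff_add_le'.2 (hfejer _ hq₀ i)
    rw [Finset.sum_range_sub'] at h
    exact h.trans (sub_le_self _ (sq_nonneg _))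
  have hu0 : Tendsto u atTop (𝓝 0) := by
    have h := tendsto_zero_of_antitone_of_summable_mul hanti_res (fun n => sq_nonneg _)
      (fun n => sq_nonneg (γ n)) hdiv hsum
    rw [tendsto_zero_iff_norm_tendsto_zero]
    simpa using h.sqrt
  have hbound (n : ℕ) : ‖x (n + 1)‖ ≤ ‖x 0 - v z₀‖ + ‖v z₀‖ := by
    have h : ‖x (n + 1) - v z₀‖ ≤ ‖x 0 - v z₀‖ :=
      (sq_le_sq₀ (norm_nonneg _) (norm_nonneg _)).1 (hanti_dist _ hq₀ (Nat.zero_le (n + 1)))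
    exact (norm_le_norm_sub_add _ (v z₀)).trans (add_le_add_left h _)
  have hcluster (q : H) (φ : ℕ → ℕ) (hφ : Tendsto φ atTop atTop)
      (hq : WeakConvergesTo ((fun n => x (n + 1)) ∘ φ) q) : (0 : H) ∈ F (vinv q) := by
    refine hgraph _ (u ∘ φ) _ 0 (hweakcont _ q hq) (hu0.comp hφ) fun n => ?_
    have h : vinv (x (φ n + 1)) = z (φ n) := by rw [hxz, hvinv_left]
    exact h ▸ hu (φ n)
  have hlim (q : H) (hq : (0 : H) ∈ F (vinv q)) :
      ∃ l : ℝ, Tendsto (fun n => ‖x (n + 1) - q‖ ^ 2) atTop (𝓝 l) := by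
    have hbdd : BddBelow (Set.range fun n => ‖x n - q‖ ^ 2) :=
      ⟨0, Set.forall_mem_range.2 fun n => sq_nonneg _⟩
    exact ⟨_, (tendsto_atTop_ciInf (hanti_dist q hq) hbdd).comp (tendsto_add_atTop_nat 1)⟩
  obtain ⟨p, hpF, hp⟩ := exists_weakConvergesTo_of_tendsto_norm_sub
    (S := {q | (0 : H) ∈ F (vinv q)}) hbound hcluster hlim
  exact ⟨p, fun y => (tendsto_add_atTop_iff_nat (f := fun n => ⟪x n, y⟫) 1).1 (hp y), hpF⟩
end
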